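/- Let λ₁, λ₂, λ₃ ∈ ℝ, let [·,·] be the Table 1 bracket on ℝ⁶, g the Norden metric, J the almost complex structure with Jeᵢ = e_{i+3}, Je_{i+3} = −eᵢ for i = 1,2,3, and R(x,y,z,u) := −(1/4)·g([x,y],[z,u]). Then the holomorphic sectional curvatures vanish: for i = 1,2,3 the planes αᵢ = span{eᵢ, e_{i+3}} are non-degenerate (g(eᵢ,eᵢ)·g(e_{i+3},e_{i+3}) − g(eᵢ,e_{i+3})² = −1 ≠ 0) and J-invariant, and k(eᵢ, e_{i+3}) = R(eᵢ, e_{i+3}, e_{i+3}, eᵢ) / (g(eᵢ,eᵢ)·g(e_{i+3},e_{i+3}) − g(eᵢ,e_{i+3})²) = 0. -/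

import Mathlib

noncomputable section

open Finset

/-- Component `k` of the Table 1 bracket `[e_i, e_j]` (indices 0–5 for e₁–e₆). -/
def tbl (l1 l2 l3 : ℝ) : Fin 6 → Fin 6 → Fin 6 → ℝ :=
  let v12 : Fin 6 → ℝ := ![0, 0, 0, l2, l3, 0]
  let v13 : Fin 6 → ℝ := ![0, 0, 0, -l1, 0, -l3]
  let v14 : Fin 6 → ℝ := ![0, l2, -l1, 0, l2, -l1]
  let v15 : Fin 6 → ℝ := ![0, l3, 0, -l2, 0, 0]
  let v16 : Fin 6 → ℝ := ![0, 0, -l3, l1, 0, 0]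
  let v23 : Fin 6 → ℝ := ![0, 0, 0, 0, l1, l2]
  let v24 : Fin 6 → ℝ := ![-l2, 0, 0, 0, l3, 0]
  let v25 : Fin 6 → ℝ := ![-l3, 0, l1, -l3, 0, l1]
  let v26 : Fin 6 → ℝ := ![0, 0, l2, 0, -l1, 0]
  let v34 : Fin 6 → ℝ := ![l1, 0, 0, 0, 0, -l3]
  let v35 : Fin 6 → ℝ := ![0, -l1, 0, 0, 0, l2]
  let v36 : Fin 6 → ℝ := ![l3, -l2, 0, l3, -l2, 0]
  let v45 : Fin 6 → ℝ := ![-l2, -l3, 0, 0, 0, 0]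
  let v46 : Fin 6 → ℝ := ![l1, 0, l3, 0, 0, 0]
  let v56 : Fin 6 → ℝ := ![0, -l1, -l2, 0, 0, 0]
  ![![0, v12, v13, v14, v15, v16],
    ![-v12, 0, v23, v24, v25, v26],
    ![-v13, -v23, 0, v34, v35, v36],
    ![-v14, -v24, -v34, 0, v45, v46],
    ![-v15, -v25, -v35, -v45, 0, v56],
    ![-v16, -v26, -v36, -v46, -v56, 0]]

/-- The Table 1 bracket on ℝ⁶, extended bilinearly. -/
def br (l1 l2 l3 : ℝ) (x y : Fin 6 → ℝ) : Fin 6 → ℝ :=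
  fun k => ∑ i : Fin 6, ∑ j : Fin 6, x i * y j * tbl l1 l2 l3 i j k

/-- The standard basis of ℝ⁶. -/
def e (i : Fin 6) : Fin 6 → ℝ := Pi.single i 1

/-- The signs of the Norden metric. -/
def eps : Fin 6 → ℝ := ![1, 1, 1, -1, -1, -1]

/-- The Norden metric: diagonal with entries (1,1,1,-1,-1,-1). -/
def gN (x y : Fin 6 → ℝ) : ℝ := ∑ i : Fin 6, eps i * x i * y i

/-- The almost complex structure: J eᵢ = e_{i+3}, J e_{i+3} = −eᵢ (i = 1,2,3). -/
def JN (x : Fin 6 → ℝ) : Fin 6 → ℝ := ![-x 3, -x 4, -x 5, x 0, x 1, x 2]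

/-- The fundamental tensor F(x,y,z) = g((∇ₓJ)y, z) with ∇ₓy = (1/2)[x,y]. -/
def FT (l1 l2 l3 : ℝ) (x y z : Fin 6 → ℝ) : ℝ :=
  (1/2 : ℝ) * (gN (br l1 l2 l3 x (JN y)) z - gN (br l1 l2 l3 x y) (JN z))

/-- The (0,4)-curvature tensor R(x,y,z,u) = −(1/4)g([x,y],[z,u]). -/
def RT (l1 l2 l3 : ℝ) (x y z u : Fin 6 → ℝ) : ℝ :=
  -(1/4 : ℝ) * gN (br l1 l2 l3 x y) (br l1 l2 l3 z u)

/-- The Ricci tensor ρ(y,z) = Σᵢ εᵢ R(eᵢ,y,z,eᵢ). -/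
def ricT (l1 l2 l3 : ℝ) (y z : Fin 6 → ℝ) : ℝ :=
  ∑ i : Fin 6, eps i * RT l1 l2 l3 (e i) y z (e i)

/-- The sectional curvature of the plane spanned by x, y. -/
def kT (l1 l2 l3 : ℝ) (x y : Fin 6 → ℝ) : ℝ :=
  RT l1 l2 l3 x y y x / (gN x x * gN y y - gN x y ^ 2)

/-- The matrix of ad x : v ↦ [x,v]. -/
def adM (l1 l2 l3 : ℝ) (x : Fin 6 → ℝ) : Matrix (Fin 6) (Fin 6) ℝ :=
  Matrix.of fun k j => br l1 l2 l3 x (e j) k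

/-- The Killing form B(x,y) = tr(ad x ∘ ad y). -/
def KB (l1 l2 l3 : ℝ) (x y : Fin 6 → ℝ) : ℝ :=
  Matrix.trace (adM l1 l2 l3 x * adM l1 l2 l3 y)

theorem br_e_e (l1 l2 l3 : ℝ) (i j : Fin 6) :
    br l1 l2 l3 (e i) (e j) = tbl l1 l2 l3 i j := by
  funext k
  simp [br, e, Pi.single_apply]

theorem tbl_swap (l1 l2 l3 : ℝ) (i j : Fin 6) :
    tbl l1 l2 l3 j i = -tbl l1 l2 l3 i j := by
  fin_cases i <;> fin_cases j <;> simp [tbl]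

theorem gN_e_e (i j : Fin 6) : gN (e i) (e j) = if i = j then eps i else 0 := by
  rcases eq_or_ne i j with rfl | h
  · simp [gN, e, Pi.single_apply]
  · simp [gN, e, Pi.single_apply, h, h.symm]

theorem gN_neg_right (x y : Fin 6 → ℝ) : gN x (-y) = -gN x y := by
  simp [gN]

/-- The sectional curvature of a coordinate plane vanishes when its bracket is isotropic. -/
theorem kT_e_e_eq_zero {l1 l2 l3 : ℝ} {i j : Fin 6}
    (h : gN (tbl l1 l2 l3 i j) (tbl l1 l2 l3 i j) = 0) : kT l1 l2 l3 (e i) (e j) = 0 := by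
  simp [kT, RT, br_e_e, tbl_swap l1 l2 l3 i j, gN_neg_right, h]

theorem gN_tbl_holomorphic_eq_zero (l1 l2 l3 : ℝ) {i : Fin 6} (hi : i = 0 ∨ i = 1 ∨ i = 2) :
    gN (tbl l1 l2 l3 i (i + 3)) (tbl l1 l2 l3 i (i + 3)) = 0 := by
  rcases hi with rfl | rfl | rfl <;> simp [gN, tbl, eps, Fin.sum_univ_six]

/-- Proposition 4.3: the holomorphic 2-planes αᵢ = span{eᵢ, e_{i+3}} (i = 1,2,3) are
non-degenerate and J-invariant, and their holomorphic sectional curvatures vanish. -/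
theorem table1_holomorphic_sectional_curvatures (l1 l2 l3 : ℝ) :
    ∀ i : Fin 6, i = 0 ∨ i = 1 ∨ i = 2 →
      (gN (e i) (e i) * gN (e (i + 3)) (e (i + 3)) - gN (e i) (e (i + 3)) ^ 2 = -1) ∧
      JN (e i) = e (i + 3) ∧ JN (e (i + 3)) = -e i ∧
      kT l1 l2 l3 (e i) (e (i + 3)) = 0 := by
  intro i hi
  refine ⟨?_, ?_, ?_, kT_e_e_eq_zero (gN_tbl_holomorphic_eq_zero l1 l2 l3 hi)⟩
  · rcases hi with rfl | rfl | rfl <;> simp [gN_e_e, eps]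
  all_goals
    rcases hi with rfl | rfl | rfl <;> funext k <;> fin_cases k <;>
      simp [JN, e]
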